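/- arXiv:0904.1479 — 2 statements merged into one kernel-verified Lean document; each statement's English description precedes it below -/
import Mathlib

section
/- (Local stability) Let d ≥ 2 and ε > 0, and set δ = 4ε^{1/6}. There exists n_0 = n_0(ε,d) such that for all n ≥ n_0 the following holds: if S ⊆ V_n is G_d-free with |S| ≥ (2/3 − ε)2^n, then there exists T ⊆ V_n with |T| ≤ δ·2^n such that (a) h_1(x) ≥ (1−δ)n for all x ∈ V_n \ (S ∪ T); (b) |h_1(x) − n/2| ≤ δn for all x ∈ S \ T; and (c) |S^2(x) Δ (B([n],2) \ B(S^1(x),2))| ≤ δ·C(n,2) for all x ∈ S \ T, where Δ denotes symmetric difference and C(n,2) = n(n−1)/2. -/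
open Finset Filter Topology

/-- The weight of a vertex of the hypercube `{0,1}^n`: number of coordinates equal to 1. -/
def cubeWeight {n : ℕ} (x : Fin n → Bool) : ℕ :=
  (Finset.univ.filter fun i => x i = true).card

/-- The support of a vertex of the hypercube: the set of coordinates equal to 1. -/
def cubeSupp {n : ℕ} (x : Fin n → Bool) : Finset (Fin n) :=
  Finset.univ.filter fun i => x i = true

/-- An embedding of the `d`-dimensional hypercube `Q_d` into `Q_n`: an injective map on
vertices that preserves the edges (pairs at Hamming distance 1). -/
def IsCubeEmbedding {d n : ℕ} (i : (Fin d → Bool) → (Fin n → Bool)) : Prop :=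
  Function.Injective i ∧
    ∀ x y : Fin d → Bool, hammingDist x y = 1 → hammingDist (i x) (i y) = 1

/-- `S ⊆ V_n` is `F`-free (for `F ⊆ V_d`) if no embedding `i : Q_d → Q_n` has `i(F) ⊆ S`. -/
def IsFree {d n : ℕ} (F : Set (Fin d → Bool)) (S : Set (Fin n → Bool)) : Prop :=
  ∀ i : (Fin d → Bool) → (Fin n → Bool), IsCubeEmbedding i → ¬ (i '' F ⊆ S)

/-- `exc n F`: the maximum size of an `F`-free subset of `V_n = {0,1}^n`. -/
noncomputable def exc {d : ℕ} (n : ℕ) (F : Set (Fin d → Bool)) : ℕ :=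
  sSup {k : ℕ | ∃ S : Finset (Fin n → Bool), IsFree F (S : Set (Fin n → Bool)) ∧ S.card = k}

/-- The configuration G_d ⊆ V_d: all vertices of weight 0 or 1, together with all vertices of
weight 2 whose support {i,j} has i ≢ j (mod 2). -/
def Gconf (d : ℕ) : Set (Fin d → Bool) :=
  {x | cubeWeight x = 0 ∨ cubeWeight x = 1 ∨
    (cubeWeight x = 2 ∧ ∃ i j : Fin d, (i : ℕ) % 2 ≠ (j : ℕ) % 2 ∧ cubeSupp x = {i, j})}

/-- h_l(x) = |S ∩ Γ_l(x)|: the number of elements of S at Hamming distance exactly l from x. -/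
def hcount {n : ℕ} (S : Finset (Fin n → Bool)) (l : ℕ) (x : Fin n → Bool) : ℕ :=
  (S.filter fun y => hammingDist x y = l).card

/-- S^l(x) = { supp(x) Δ supp(y) : y ∈ S ∩ Γ_l(x) }, a family of l-element subsets of [n]. -/
def Sfam {n : ℕ} (S : Finset (Fin n → Bool)) (l : ℕ) (x : Fin n → Bool) :
    Finset (Finset (Fin n)) :=
  (S.filter fun y => hammingDist x y = l).image fun y => symmDiff (cubeSupp x) (cubeSupp y)

/-- S^1(x) viewed as a subset of [n]: the coordinates whose flip takes x into S. -/
def S1set {n : ℕ} (S : Finset (Fin n → Bool)) (x : Fin n → Bool) : Finset (Fin n) :=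
  Finset.univ.filter fun i => Function.update x i (!(x i)) ∈ S


/-- Flip one coordinate. -/
def cflip {n : ℕ} (x : Fin n → Bool) (i : Fin n) : Fin n → Bool :=
  Function.update x i (!(x i))

lemma cflip_apply {n : ℕ} (x : Fin n → Bool) (i k : Fin n) :
    cflip x i k = if k = i then !(x k) else x k := by
  unfold cflip
  by_cases h : k = i
  · subst h; simp
  · simp [h]

lemma cflip_cflip {n : ℕ} (x : Fin n → Bool) (i : Fin n) : cflip (cflip x i) i = x := by
  funext k
  simp only [cflip_apply]
  split_ifs <;> simp

lemma cflip_comm {n : ℕ} (x : Fin n → Bool) (i j : Fin n) :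
    cflip (cflip x i) j = cflip (cflip x j) i := by
  funext k
  simp only [cflip_apply]
  split_ifs <;> simp

lemma mem_S1set {n : ℕ} (S : Finset (Fin n → Bool)) (x : Fin n → Bool) (i : Fin n) :
    i ∈ S1set S x ↔ cflip x i ∈ S := by
  simp [S1set, cflip]

lemma hammingDist_eq_one_iff {n : ℕ} (x y : Fin n → Bool) :
    hammingDist x y = 1 ↔ ∃ i, y = cflip x i := by
  unfold hammingDist
  rw [Finset.card_eq_one]
  constructor
  · rintro ⟨i, hi⟩
    refine ⟨i, ?_⟩
    funext k
    have := congrArg (fun s => k ∈ s) hi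
    simp only [mem_filter, mem_univ, true_and, mem_singleton, eq_iff_iff] at this
    rw [cflip_apply]
    split_ifs with h
    · have := this.2 h
      revert this; cases x k <;> cases y k <;> simp
    · have := mt this.1 h
      push Not at this; exact this.symm
  · rintro ⟨i, rfl⟩
    refine ⟨i, ?_⟩
    ext k
    simp only [mem_filter, mem_univ, true_and, mem_singleton, cflip_apply]
    split_ifs with h <;> simp [h]

lemma cflip_inj {n : ℕ} (x : Fin n → Bool) : Function.Injective (cflip x) := by
  intro i j h
  have := congrFun h i
  simp only [cflip_apply] at this
  by_contra hne
  simp [hne] at this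

lemma hcount_one {n : ℕ} (S : Finset (Fin n → Bool)) (x : Fin n → Bool) :
    hcount S 1 x = (S1set S x).card := by
  unfold hcount
  rw [← Finset.card_image_of_injective (S1set S x) (cflip_inj x)]
  congr 1
  ext y
  simp only [mem_filter, mem_image, mem_S1set, hammingDist_eq_one_iff]
  constructor
  · rintro ⟨h, i, rfl⟩
    exact ⟨i, h, rfl⟩
  · rintro ⟨i, h, rfl⟩
    exact ⟨h, i, rfl⟩

lemma mem_Sfam_two {n : ℕ} (S : Finset (Fin n → Bool)) (x : Fin n → Bool) (i j : Fin n)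
    (hij : i ≠ j) : ({i, j} : Finset (Fin n)) ∈ Sfam S 2 x ↔ cflip (cflip x i) j ∈ S := by
  have key : ∀ y : Fin n → Bool, symmDiff (cubeSupp x) (cubeSupp y)
      = Finset.univ.filter fun k => x k ≠ y k := by
    intro y
    ext k
    simp only [cubeSupp, mem_symmDiff, mem_filter, mem_univ, true_and]
    cases x k <;> cases y k <;> simp
  have key2 : (Finset.univ.filter fun k => x k ≠ cflip (cflip x i) j k) = {i, j} := by
    ext k
    simp only [mem_filter, mem_univ, true_and, mem_insert, mem_singleton, cflip_apply]
    by_cases h1 : k = i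
    · subst h1; simp [hij]
    · by_cases h2 : k = j
      · subst h2; simp [h1]
      · simp [h1, h2]
  unfold Sfam
  simp only [mem_image, mem_filter]
  constructor
  · rintro ⟨y, ⟨hy, -⟩, h⟩
    rw [key, ← key2] at h
    convert hy using 1
    funext k
    have := congrArg (fun s => k ∈ s) h
    simp only [mem_filter, mem_univ, true_and, eq_iff_iff] at this
    revert this
    cases x k <;> cases y k <;> cases (cflip (cflip x i) j k) <;> simp
  · intro h
    refine ⟨_, ⟨h, ?_⟩, ?_⟩
    · unfold hammingDist
      rw [key2, Finset.card_pair hij]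
    · rw [key, key2]

/-- The embedding of a cube at `x` along directions `c`. -/
def cemb {d n : ℕ} (x : Fin n → Bool) (c : Fin d → Fin n) (y : Fin d → Bool) : Fin n → Bool :=
  fun k => xor (x k) (decide (∃ i, c i = k ∧ y i = true))

lemma cemb_isEmb {d n : ℕ} (x : Fin n → Bool) (c : Fin d → Fin n) (hc : Function.Injective c) :
    IsCubeEmbedding (cemb x c) := by
  have key : ∀ y z, hammingDist (cemb x c y) (cemb x c z) = hammingDist y z := by
    intro y z
    unfold hammingDist
    rw [← Finset.card_image_of_injective _ hc]
    congr 1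
    ext k
    rw [mem_filter, mem_image]
    simp only [mem_filter, mem_univ, true_and]
    unfold cemb
    constructor
    · intro h
      by_cases hk : ∃ i, c i = k
      · obtain ⟨i, rfl⟩ := hk
        refine ⟨i, ?_, rfl⟩
        intro hyz
        apply h
        simp [hc.eq_iff, hyz]
      · exfalso
        push Not at hk
        simp [hk] at h
    · rintro ⟨i, h, rfl⟩
      simpa [hc.eq_iff] using h
  constructor
  · intro y z h
    rw [← hammingDist_eq_zero, ← key, h, hammingDist_self]
  · intro y z h
    rw [key, h]

/-- A free set has no large bipartite configuration. -/
lemma no_bip {d n : ℕ} (S : Finset (Fin n → Bool))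
    (hS : IsFree (Gconf d) (S : Set (Fin n → Bool))) (x : Fin n → Bool) (hx : x ∈ S)
    (u w : Fin d → Fin n) (hu : Function.Injective u) (hw : Function.Injective w)
    (huw : ∀ i j, u i ≠ w j)
    (h1 : ∀ i, cflip x (u i) ∈ S) (h2 : ∀ i, cflip x (w i) ∈ S)
    (h3 : ∀ i j, cflip (cflip x (u i)) (w j) ∈ S) : False := by
  set c : Fin d → Fin n := fun i => if (i : ℕ) % 2 = 0 then u i else w i with hcdef
  have hc : Function.Injective c := by
    intro i j h
    simp only [hcdef] at h
    split_ifs at h with ha hb hb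
    · exact hu h
    · exact absurd h (huw _ _)
    · exact absurd h.symm (huw _ _)
    · exact hw h
  have hc1 : ∀ i, cflip x (c i) ∈ S := by
    intro i
    simp only [hcdef]
    split_ifs
    · exact h1 i
    · exact h2 i
  refine hS (cemb x c) (cemb_isEmb x c hc) ?_
  rintro _ ⟨y, hy, rfl⟩
  have hsupp : ∀ i, y i = true ↔ i ∈ cubeSupp y := by intro i; simp [cubeSupp]
  have hemb : cemb x c y = fun k => xor (x k) (decide (∃ i, c i = k ∧ i ∈ cubeSupp y)) := by
    funext k
    simp only [cemb, hsupp]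
  rw [hemb]
  rcases hy with hy | hy | ⟨-, i, j, hij, hy⟩
  · have : cubeSupp y = ∅ := Finset.card_eq_zero.1 hy
    simpa [this] using hx
  · obtain ⟨i, hi⟩ := Finset.card_eq_one.1 (show (cubeSupp y).card = 1 from hy)
    convert Finset.mem_coe.2 (hc1 i) using 1
    funext k
    rw [hi, cflip_apply]
    by_cases h : k = c i
    · simp [h]
    · simp [h, Ne.symm h]
  · have hne : i ≠ j := by rintro rfl; exact hij rfl
    have hm : cflip (cflip x (c i)) (c j) ∈ S := by
      simp only [hcdef]
      split_ifs with ha hb hb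
      · omega
      · exact h3 i j
      · rw [cflip_comm]; exact h3 j i
      · omega
    convert Finset.mem_coe.2 hm using 1
    funext k
    rw [hy, cflip_apply, cflip_apply]
    have hcne : c i ≠ c j := fun h => hne (hc h)
    have hiff : (∃ i_1, c i_1 = k ∧ i_1 ∈ ({i, j} : Finset (Fin d))) ↔ (k = c i ∨ k = c j) := by
      constructor
      · rintro ⟨a, rfl, ha⟩
        rcases Finset.mem_insert.1 ha with rfl | ha
        · exact Or.inl rfl
        · rw [Finset.mem_singleton] at ha; subst ha; exact Or.inr rfl
      · rintro (h | h)
        · exact ⟨i, h.symm, by simp⟩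
        · exact ⟨j, h.symm, by simp⟩
    simp only [hiff]
    by_cases h : k = c i
    · subst h; simp [hcne]
    · by_cases hb2 : k = c j
      · subst hb2; simp [Ne.symm hcne]
      · simp [h, hb2]

/-- Number of non-injective maps. -/
lemma noninj_card (d n : ℕ) (hn : d ≤ n) (hd : 1 ≤ d) :
    (((Finset.univ : Finset (Fin d → Fin n)).filter
      fun u => ¬ Function.Injective u).card : ℝ) * n ≤ d ^ 2 * n ^ d := by
  have hn0 : (0 : ℝ) < n := by exact_mod_cast (by omega : 0 < n)
  have e1 : ((Finset.univ : Finset (Fin d → Fin n)).filter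
      fun u => Function.Injective u).card = n.descFactorial d := by
    have := Fintype.card_embedding_eq (α := Fin d) (β := Fin n)
    simp only [Fintype.card_fin] at this
    rw [← this, ← Fintype.card_congr (Equiv.subtypeInjectiveEquivEmbedding (Fin d) (Fin n)),
      Fintype.card_subtype]
  have e2 := Finset.card_filter_add_card_filter_not (s := (Finset.univ : Finset (Fin d → Fin n)))
    (fun u => Function.Injective u)
  rw [e1] at e2
  simp only [Finset.card_univ, Fintype.card_fun, Fintype.card_fin] at e2
  have e3 : ((n : ℝ) - d) ^ d ≤ n.descFactorial d := by
    have h := Nat.pow_sub_le_descFactorial n d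
    have hb2 : ((n - d : ℕ)) ^ d ≤ n.descFactorial d :=
      (Nat.pow_le_pow_left (by omega) d).trans h
    have hb3 : (((n - d : ℕ) : ℝ)) ^ d ≤ n.descFactorial d := by exact_mod_cast hb2
    rwa [Nat.cast_sub hn] at hb3
  have e4 : 1 + (d : ℝ) * (-(d / n)) ≤ (1 + -((d : ℝ) / n)) ^ d := by
    apply one_add_mul_le_pow
    have : (d : ℝ) / n ≤ 1 := by
      rw [div_le_one hn0]; exact_mod_cast hn
    linarith
  have e5 : ((n : ℝ) - d) ^ d = n ^ d * (1 + -((d : ℝ) / n)) ^ d := by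
    rw [← mul_pow]; congr 1; field_simp; ring
  have e6 : (n.descFactorial d : ℝ) + ((Finset.univ : Finset (Fin d → Fin n)).filter
      fun u => ¬ Function.Injective u).card = n ^ d := by exact_mod_cast e2
  have e7 : (n : ℝ) ^ d * (1 + (d : ℝ) * (-(d / n))) ≤ n.descFactorial d := by
    refine le_trans ?_ e3
    rw [e5]
    gcongr
  have e8 : (n : ℝ) ^ d * (1 + (d : ℝ) * (-(d / n))) * n = n ^ d * n - d ^ 2 * n ^ d := by
    field_simp
    try ring
  have e9 := mul_le_mul_of_nonneg_right e7 hn0.le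
  rw [e8] at e9
  have : (((Finset.univ : Finset (Fin d → Fin n)).filter
      fun u => ¬ Function.Injective u).card : ℝ) = n ^ d - n.descFactorial d := by linarith
  rw [this]; linarith

/-- Kővári–Sós–Turán in qualitative form. -/
lemma kst (d n : ℕ) (hd : 1 ≤ d) (hn : d ≤ n) (R : Fin n → Fin n → Prop) [DecidableRel R]
    (hno : ∀ u w : Fin d → Fin n, Function.Injective u → Function.Injective w →
      (∀ i j, u i ≠ w j) → ¬ ∀ i j, R (u i) (w j)) (η : ℝ) (hη : 0 < η)
    (hlarge : (2 * d + d ^ 2 : ℝ) ≤ n * η ^ d) :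
    (((Finset.univ : Finset (Fin n × Fin n)).filter fun p => R p.1 p.2).card : ℝ)
      ≤ η * n ^ 2 := by
  have hn0 : (0 : ℝ) < n := by exact_mod_cast (by omega : 0 < n)
  by_contra hcon
  push Not at hcon
  set deg : Fin n → ℕ := fun v => (Finset.univ.filter fun k => R k v).card with hdeg
  set nb : (Fin d → Fin n) → ℕ := fun u => (Finset.univ.filter fun v => ∀ i, R (u i) v).card
    with hnb
  have f1 : ((Finset.univ : Finset (Fin n × Fin n)).filter fun p => R p.1 p.2).card
      = ∑ v, deg v := by
    simp only [hdeg, Finset.card_filter]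
    rw [← Finset.univ_product_univ, Finset.sum_product_right]
  have f2 : ∑ v, deg v ^ d = ∑ u, nb u := by
    simp only [hnb, Finset.card_filter]
    rw [Finset.sum_comm]
    refine Finset.sum_congr rfl fun v _ => ?_
    rw [← Finset.card_filter]
    have : (Finset.univ.filter fun u : Fin d → Fin n => ∀ i, R (u i) v)
        = Fintype.piFinset fun _ => Finset.univ.filter fun k => R k v := by
      ext u; simp
    rw [this, Fintype.card_piFinset_const]
  have f3 : ∀ u, Function.Injective u → nb u ≤ 2 * d := by
    intro u hu
    by_contra hlt
    push Not at hlt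
    set N := (Finset.univ.filter fun v => ∀ i, R (u i) v) \ Finset.univ.image u with hN
    have hNc : d ≤ N.card := by
      have h1 : (Finset.univ.filter fun v => ∀ i, R (u i) v).card - (Finset.univ.image u).card
          ≤ N.card := Finset.le_card_sdiff _ _
      have h2 : (Finset.univ.image u).card ≤ d := by
        simpa using (Finset.card_image_le (s := Finset.univ) (f := u))
      simp only [hnb] at hlt
      omega
    obtain ⟨w⟩ : Nonempty (Fin d ↪ N) := by
      apply Function.Embedding.nonempty_of_card_le
      simpa using hNc
    have hw : ∀ j, ((w j : Fin n) ∈ N) := fun j => (w j).2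
    simp only [hN, Finset.mem_sdiff, mem_filter, mem_univ, true_and, mem_image, not_exists] at hw
    exact hno u (fun j => (w j : Fin n)) hu (fun a b h => w.injective (Subtype.ext h))
      (fun i j => (hw j).2 i) (fun i j => (hw j).1 i)
  have f4 : (∑ u, nb u : ℝ) ≤ 2 * d * n ^ d + d ^ 2 * n ^ d := by
    have hsplit := Finset.sum_filter_add_sum_filter_not (Finset.univ : Finset (Fin d → Fin n))
      (fun u => Function.Injective u) (fun u => (nb u : ℝ))
    rw [← hsplit]
    apply add_le_add
    · calc _ ≤ ∑ u ∈ Finset.univ.filter (fun u : Fin d → Fin n => Function.Injective u),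
            (2 * d : ℝ) := by
            apply Finset.sum_le_sum
            intro u hu
            exact_mod_cast f3 u (Finset.mem_filter.1 hu).2
        _ ≤ ∑ u : Fin d → Fin n, (2 * d : ℝ) := by
            apply Finset.sum_le_sum_of_subset_of_nonneg (Finset.filter_subset _ _)
            intros; positivity
        _ = _ := by simp; ring
    · refine le_trans ?_ (noninj_card d n hn hd)
      rw [← nsmul_eq_mul]
      apply Finset.sum_le_card_nsmul
      intro u _
      have : nb u ≤ n := by
        simp only [hnb]
        exact (Finset.card_le_univ _).trans (by simp)
      exact_mod_cast this
  obtain ⟨e, rfl⟩ : ∃ e, d = e + 1 := ⟨d - 1, by omega⟩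
  have f5 := pow_sum_div_card_le_sum_pow (s := (Finset.univ : Finset (Fin n)))
    (f := fun v => (deg v : ℝ)) (by intros; positivity) e
  have f6 : (∑ v, (deg v : ℝ) ^ (e + 1)) = ∑ u, (nb u : ℝ) := by exact_mod_cast f2
  have f7 : (∑ v, (deg v : ℝ)) > η * n ^ 2 := by
    rw [f1] at hcon; exact_mod_cast hcon
  rw [f6, div_le_iff₀ (by simp; positivity)] at f5
  simp only [Finset.card_univ, Fintype.card_fin] at f5
  have f8 : (η * n ^ 2) ^ (e + 1) < (∑ v, (deg v : ℝ)) ^ (e + 1) := by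
    gcongr
  have f9 : (∑ u, (nb u : ℝ)) * n ^ e ≤ (n * η ^ (e + 1)) * n ^ (e + 1) * n ^ e := by
    gcongr
    calc _ ≤ _ := f4
      _ = (2 * (e + 1 : ℕ) + (e + 1 : ℕ) ^ 2) * (n : ℝ) ^ (e + 1) := by ring
      _ ≤ _ := by gcongr
  have f10 : (n * η ^ (e + 1)) * (n : ℝ) ^ (e + 1) * n ^ e = (η * n ^ 2) ^ (e + 1) := by
    rw [mul_pow, ← pow_mul]; ring
  linarith

/-- Flipping coordinate `i` as a permutation of the cube. -/
def cflipEquiv {n : ℕ} (i : Fin n) : (Fin n → Bool) ≃ (Fin n → Bool) where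
  toFun x := cflip x i
  invFun x := cflip x i
  left_inv x := cflip_cflip x i
  right_inv x := cflip_cflip x i

/-- Ordered pairs whose double flip lands in `S`. -/
def Hset {n : ℕ} (S : Finset (Fin n → Bool)) (x : Fin n → Bool) : Finset (Fin n × Fin n) :=
  Finset.univ.filter fun p => cflip (cflip x p.1) p.2 ∈ S

/-- Ordered pairs in the symmetric difference. -/
def SDset {n : ℕ} (S : Finset (Fin n → Bool)) (x : Fin n → Bool) : Finset (Fin n × Fin n) :=
  Finset.univ.filter fun p =>
    (cflip (cflip x p.1) p.2 ∈ S ↔ (p.1 ∈ S1set S x ∧ p.2 ∈ S1set S x))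

/-- Ordered pairs inside `S1set` whose double flip lands in `S`. -/
def Pset {n : ℕ} (S : Finset (Fin n → Bool)) (x : Fin n → Bool) : Finset (Fin n × Fin n) :=
  Finset.univ.filter fun p =>
    (p.1 ∈ S1set S x ∧ p.2 ∈ S1set S x) ∧ cflip (cflip x p.1) p.2 ∈ S

lemma S1card {n : ℕ} (S : Finset (Fin n → Bool)) (x : Fin n → Bool) :
    (S1set S x).card = ∑ i, if cflip x i ∈ S then 1 else 0 := by
  rw [← Finset.card_filter]
  congr 1

lemma sum_S1 {n : ℕ} (S : Finset (Fin n → Bool)) :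
    ∑ x, (S1set S x).card = n * S.card := by
  simp only [S1card]
  rw [Finset.sum_comm]
  have : ∀ i : Fin n, (∑ x, if cflip x i ∈ S then 1 else 0) = S.card := by
    intro i
    have h := (cflipEquiv i).sum_comp (fun x => if x ∈ S then 1 else 0)
    refine Eq.trans h ?_
    simp
  simp [this]

lemma sum_S1_sq {n : ℕ} (S : Finset (Fin n → Bool)) :
    ∑ x, (S1set S x).card ^ 2 = ∑ x ∈ S, (Hset S x).card := by
  have e1 : ∀ x, (S1set S x).card ^ 2
      = ∑ i, ∑ j, if cflip x i ∈ S ∧ cflip x j ∈ S then 1 else 0 := by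
    intro x
    rw [sq, S1card, Finset.sum_mul_sum]
    refine Finset.sum_congr rfl fun i _ => Finset.sum_congr rfl fun j _ => ?_
    split_ifs <;> simp_all
  have e2 : ∀ x, (Hset S x).card = ∑ i, ∑ j, if cflip (cflip x i) j ∈ S then 1 else 0 := by
    intro x
    rw [Hset, Finset.card_filter, ← Finset.univ_product_univ, Finset.sum_product]
  have e3 : ∑ x ∈ S, (Hset S x).card
      = ∑ x, ∑ i, ∑ j, if x ∈ S ∧ cflip (cflip x i) j ∈ S then 1 else 0 := by
    have h : ∑ x ∈ S, (Hset S x).card = ∑ x, if x ∈ S then (Hset S x).card else 0 := by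
      rw [← Finset.sum_filter, Finset.filter_mem_eq_inter, Finset.univ_inter]
    rw [h]
    refine Finset.sum_congr rfl fun x _ => ?_
    rw [e2]
    by_cases hx : x ∈ S <;> simp [hx]
  rw [e3]
  simp only [e1]
  rw [Finset.sum_comm, Finset.sum_comm (s := (Finset.univ : Finset (Fin n → Bool)))]
  refine Finset.sum_congr rfl fun i _ => ?_
  rw [← (cflipEquiv i).sum_comp (fun x => ∑ j, if x ∈ S ∧ cflip (cflip x i) j ∈ S then 1 else 0)]
  refine Finset.sum_congr rfl fun x _ => ?_
  simp [cflipEquiv, cflip_cflip]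

lemma SD_ident {n : ℕ} (S : Finset (Fin n → Bool)) (x : Fin n → Bool) :
    (SDset S x).card + (S1set S x).card ^ 2 + (Hset S x).card = n ^ 2 + 2 * (Pset S x).card := by
  have e1 : (S1set S x).card ^ 2 = ((Finset.univ : Finset (Fin n × Fin n)).filter
      fun p => p.1 ∈ S1set S x ∧ p.2 ∈ S1set S x).card := by
    rw [sq, ← Finset.card_product]
    congr 1
    ext p
    simp
  have e2 : n ^ 2 = ∑ p : Fin n × Fin n, 1 := by simp [sq]
  rw [e1, e2, SDset, Hset, Pset]
  simp only [Finset.card_filter]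
  rw [Finset.mul_sum, ← Finset.sum_add_distrib, ← Finset.sum_add_distrib,
    ← Finset.sum_add_distrib]
  refine Finset.sum_congr rfl fun p _ => ?_
  by_cases h1 : cflip (cflip x p.1) p.2 ∈ S <;>
    by_cases h2 : p.1 ∈ S1set S x ∧ p.2 ∈ S1set S x <;> simp [h1, h2]

lemma two_symm_le {n : ℕ} (S : Finset (Fin n → Bool)) (x : Fin n → Bool) :
    2 * (symmDiff (Sfam S 2 x) ((Finset.powersetCard 2 (Finset.univ : Finset (Fin n))) \
      (Finset.powersetCard 2 (S1set S x)))).card ≤ (SDset S x).card := by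
  set D := symmDiff (Sfam S 2 x) ((Finset.powersetCard 2 (Finset.univ : Finset (Fin n))) \
      (Finset.powersetCard 2 (S1set S x))) with hD
  have hmem : ∀ i j : Fin n, i ≠ j → ({i, j} : Finset (Fin n)) ∈ D → (i, j) ∈ SDset S x := by
    intro i j hij h
    have hc : ({i, j} : Finset (Fin n)).card = 2 := Finset.card_pair hij
    simp only [hD, Finset.mem_symmDiff, Finset.mem_sdiff, Finset.mem_powersetCard, hc,
      Finset.insert_subset_iff, Finset.singleton_subset_iff, mem_Sfam_two S x i j hij] at h
    simp only [SDset, mem_filter, mem_univ, true_and]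
    simp only [mem_univ, true_and, and_true] at h
    tauto
  have htwo : ∀ s ∈ D, ∃ i j : Fin n, i ≠ j ∧ s = {i, j} := by
    intro s hs
    have : s.card = 2 := by
      rw [hD, Finset.mem_symmDiff] at hs
      rcases hs with ⟨hs, -⟩ | ⟨hs, -⟩
      · simp only [Sfam, mem_image, mem_filter] at hs
        obtain ⟨y, ⟨-, hy⟩, rfl⟩ := hs
        rw [← hy]
        unfold hammingDist
        congr 1
        ext k
        simp only [cubeSupp, Finset.mem_symmDiff, mem_filter, mem_univ, true_and]
        cases x k <;> cases y k <;> simp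
      · rw [Finset.mem_sdiff, Finset.mem_powersetCard] at hs
        exact hs.1.2
    rw [Finset.card_eq_two] at this
    obtain ⟨i, j, h, hb2⟩ := this
    exact ⟨i, j, h, hb2⟩
  have h1 : ∑ s ∈ D, ((SDset S x).filter fun p => ({p.1, p.2} : Finset (Fin n)) = s).card
      ≤ (SDset S x).card := by
    rw [Finset.sum_card_fiberwise_eq_card_filter]
    exact Finset.card_filter_le _ _
  refine le_trans ?_ h1
  rw [mul_comm, ← smul_eq_mul]
  apply Finset.card_nsmul_le_sum
  intro s hs
  obtain ⟨i, j, hij, rfl⟩ := htwo s hs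
  have hsub : ({(i, j), (j, i)} : Finset (Fin n × Fin n)) ⊆
      (SDset S x).filter fun p => ({p.1, p.2} : Finset (Fin n)) = {i, j} := by
    intro p hp
    rw [Finset.mem_insert, Finset.mem_singleton] at hp
    rw [Finset.mem_filter]
    rcases hp with rfl | rfl
    · exact ⟨hmem i j hij hs, rfl⟩
    · exact ⟨hmem j i hij.symm (by rw [Finset.pair_comm]; exact hs), Finset.pair_comm _ _⟩
  refine le_trans (le_of_eq ?_) (Finset.card_le_card hsub)
  rw [Finset.card_pair]
  intro h
  exact hij (Prod.ext_iff.1 h).1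

/-- The total defect at a vertex. -/
noncomputable def Wdef {n : ℕ} (S : Finset (Fin n → Bool)) (x : Fin n → Bool) : ℝ :=
  if x ∈ S then 2 * ((S1set S x).card - (n : ℝ) / 2) ^ 2 + (SDset S x).card
  else ((n : ℝ) - (S1set S x).card) ^ 2

lemma sum_W {n : ℕ} (S : Finset (Fin n → Bool)) :
    ∑ x, Wdef S x = n ^ 2 * 2 ^ n - 3 / 2 * n ^ 2 * S.card + 2 * ∑ x ∈ S, ((Pset S x).card : ℝ) := by
  have e1 : ∑ x, ((S1set S x).card : ℝ) = n * S.card := by exact_mod_cast sum_S1 S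
  have e2 : ∑ x, ((S1set S x).card : ℝ) ^ 2 = ∑ x ∈ S, ((Hset S x).card : ℝ) := by
    exact_mod_cast sum_S1_sq S
  have e3 : ∀ x, Wdef S x = ((S1set S x).card : ℝ) ^ 2 - 2 * n * (S1set S x).card + n ^ 2
      + if x ∈ S then (n : ℝ) ^ 2 / 2 + 2 * (Pset S x).card - (Hset S x).card else 0 := by
    intro x
    have h : ((SDset S x).card : ℝ) + (S1set S x).card ^ 2 + (Hset S x).card
      = n ^ 2 + 2 * (Pset S x).card := by exact_mod_cast SD_ident S x
    have hb2 : ((SDset S x).card : ℝ) = n ^ 2 + 2 * (Pset S x).card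
      - (S1set S x).card ^ 2 - (Hset S x).card := by linarith
    unfold Wdef
    split_ifs
    · rw [hb2]; ring
    · ring
  simp only [e3]
  rw [Finset.sum_add_distrib, Finset.sum_add_distrib, Finset.sum_sub_distrib, ← Finset.mul_sum, e1,
    e2, ← Finset.sum_filter, Finset.filter_mem_eq_inter, Finset.univ_inter,
    Finset.sum_sub_distrib, Finset.sum_add_distrib, ← Finset.mul_sum]
  simp only [Finset.sum_const, Finset.card_univ, Fintype.card_fun, Fintype.card_bool,
    Fintype.card_fin, nsmul_eq_mul]
  push_cast
  ring

lemma W_nonneg {n : ℕ} (S : Finset (Fin n → Bool)) (x : Fin n → Bool) : 0 ≤ Wdef S x := by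
  unfold Wdef
  split_ifs <;> positivity

lemma P_le {d n : ℕ} (hd : 1 ≤ d) (hn : d ≤ n) (S : Finset (Fin n → Bool))
    (hS : IsFree (Gconf d) (S : Set (Fin n → Bool))) (x : Fin n → Bool) (hx : x ∈ S)
    (η : ℝ) (hη : 0 < η) (hlarge : (2 * d + d ^ 2 : ℝ) ≤ n * η ^ d) :
    ((Pset S x).card : ℝ) ≤ η * n ^ 2 := by
  refine kst d n hd hn (fun i j => (i ∈ S1set S x ∧ j ∈ S1set S x) ∧ cflip (cflip x i) j ∈ S)
    ?_ η hη hlarge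
  intro u w hu hw huw h
  refine no_bip S hS x hx u w hu hw huw ?_ ?_ (fun i j => (h i j).2)
  · intro i; exact (mem_S1set S x _).1 (h i i).1.1
  · intro i; exact (mem_S1set S x _).1 (h i i).1.2

/-- Local stability: a G_d-free set of density at least 2/3 − ε locally resembles the
two-out-of-three-layers construction, with δ = 4ε^(1/6). -/
theorem local_stability (d : ℕ) (hd : 2 ≤ d) (ε : ℝ) (hε : 0 < ε) :
    ∃ n₀ : ℕ, ∀ n : ℕ, n₀ ≤ n → ∀ S : Finset (Fin n → Bool),
      IsFree (Gconf d) (S : Set (Fin n → Bool)) →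
      (2 / 3 - ε) * 2 ^ n ≤ (S.card : ℝ) →
      ∃ T : Finset (Fin n → Bool),
        (T.card : ℝ) ≤ 4 * ε ^ ((1 : ℝ) / 6) * 2 ^ n ∧
        (∀ x : Fin n → Bool, x ∉ S → x ∉ T →
          (1 - 4 * ε ^ ((1 : ℝ) / 6)) * n ≤ (hcount S 1 x : ℝ)) ∧
        (∀ x ∈ S, x ∉ T →
          |(hcount S 1 x : ℝ) - n / 2| ≤ 4 * ε ^ ((1 : ℝ) / 6) * n) ∧
        (∀ x ∈ S, x ∉ T →
          ((symmDiff (Sfam S 2 x)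
              ((Finset.powersetCard 2 (Finset.univ : Finset (Fin n))) \ (Finset.powersetCard 2 (S1set S x)))).card : ℝ) ≤
            4 * ε ^ ((1 : ℝ) / 6) * (n.choose 2)) := by
  set δ : ℝ := 4 * ε ^ ((1 : ℝ) / 6) with hδ
  have hδ0 : 0 < δ := by positivity
  by_cases hbig : 1 < δ
  · refine ⟨0, fun n _ S _ _ => ⟨Finset.univ, ?_, ?_, ?_, ?_⟩⟩
    · have h2 : (0 : ℝ) < 2 ^ n := by positivity
      simp only [Finset.card_univ, Fintype.card_fun, Fintype.card_bool, Fintype.card_fin]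
      push_cast
      nlinarith
    · intro x _ hx; exact absurd (Finset.mem_univ x) hx
    · intro x _ hx; exact absurd (Finset.mem_univ x) hx
    · intro x _ hx; exact absurd (Finset.mem_univ x) hx
  push Not at hbig
  -- `4 ε ≤ δ ^ 3`
  have hδ3 : 4 * ε ≤ δ ^ 3 := by
    have h6 : δ ^ 6 = 4 ^ 6 * ε := by
      rw [hδ, mul_pow, ← Real.rpow_natCast (ε ^ _), ← Real.rpow_mul hε.le]
      norm_num
    have : δ ^ 6 ≤ δ ^ 3 := pow_le_pow_of_le_one hδ0.le hbig (by norm_num)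
    nlinarith
  clear_value δ
  obtain ⟨m, hm⟩ := exists_nat_ge ((2 * d + d ^ 2 : ℝ) / (ε / 4) ^ d)
  refine ⟨max m d, fun n hn S hS hcard => ?_⟩
  have hdn : d ≤ n := (le_max_right _ _).trans hn
  have hmn : (m : ℝ) ≤ n := by exact_mod_cast (le_max_left _ _).trans hn
  have hlarge : (2 * d + d ^ 2 : ℝ) ≤ n * (ε / 4) ^ d := by
    rw [← div_le_iff₀ (by positivity)]
    exact hm.trans hmn
  have hn2 : (2 : ℝ) ≤ n := by exact_mod_cast hd.trans hdn
  have hnpos : (0 : ℝ) < n := by linarith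
  have hP : ∑ x ∈ S, ((Pset S x).card : ℝ) ≤ 2 ^ n * (ε / 4 * n ^ 2) := by
    calc _ ≤ S.card • (ε / 4 * (n : ℝ) ^ 2) := Finset.sum_le_card_nsmul _ _ _ fun x hx =>
            P_le (by omega) hdn S hS x hx (ε / 4) (by positivity) hlarge
      _ ≤ _ := by
        rw [nsmul_eq_mul]
        gcongr
        have := Finset.card_le_univ S
        simp only [Fintype.card_fun, Fintype.card_bool, Fintype.card_fin] at this
        exact_mod_cast this
  have hW : ∑ x, Wdef S x ≤ 2 * ε * n ^ 2 * 2 ^ n := by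
    rw [sum_W]
    have h1 : (n : ℝ) ^ 2 * ((2 / 3 - ε) * 2 ^ n) ≤ n ^ 2 * S.card := by gcongr
    nlinarith
  set T := Finset.univ.filter fun x => δ ^ 2 / 2 * (n : ℝ) ^ 2 < Wdef S x with hT
  have hnT : ∀ x, x ∉ T → Wdef S x ≤ δ ^ 2 / 2 * (n : ℝ) ^ 2 := by
    intro x hx
    by_contra h
    push Not at h
    exact hx (Finset.mem_filter.2 ⟨Finset.mem_univ _, h⟩)
  have hdn2 : δ ^ 2 / 2 * (n : ℝ) ^ 2 ≤ (δ * n) ^ 2 := by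
    have : 0 ≤ (δ * n) ^ 2 := by positivity
    nlinarith
  refine ⟨T, ?_, ?_, ?_, ?_⟩
  · have h1 : T.card • (δ ^ 2 / 2 * (n : ℝ) ^ 2) ≤ ∑ x ∈ T, Wdef S x :=
      Finset.card_nsmul_le_sum _ _ _ fun x hx => (Finset.mem_filter.1 hx).2.le
    have h2 : ∑ x ∈ T, Wdef S x ≤ ∑ x, Wdef S x :=
      Finset.sum_le_sum_of_subset_of_nonneg (Finset.subset_univ _) fun x _ _ => W_nonneg S x
    rw [nsmul_eq_mul] at h1
    have h3 : (T.card : ℝ) * (δ ^ 2 / 2 * (n : ℝ) ^ 2) ≤ (δ * 2 ^ n) * (δ ^ 2 / 2 * (n : ℝ) ^ 2) := by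
      calc _ ≤ 2 * ε * (n : ℝ) ^ 2 * 2 ^ n := h1.trans (h2.trans hW)
        _ = (4 * ε) * ((n : ℝ) ^ 2 * 2 ^ n / 2) := by ring
        _ ≤ δ ^ 3 * ((n : ℝ) ^ 2 * 2 ^ n / 2) := by gcongr
        _ = _ := by ring
    exact le_of_mul_le_mul_right h3 (by positivity)
  · intro x hxS hxT
    have h := (hnT x hxT).trans hdn2
    rw [Wdef, if_neg hxS] at h
    have := abs_le_of_sq_le_sq' h (by positivity)
    rw [hcount_one]
    linarith [this.2]
  · intro x hxS hxT
    have h := hnT x hxT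
    rw [Wdef, if_pos hxS] at h
    rw [hcount_one]
    apply abs_le_of_sq_le_sq _ (by positivity)
    have h0 : (0 : ℝ) ≤ (SDset S x).card := by positivity
    have h1 : 0 ≤ (((S1set S x).card : ℝ) - n / 2) ^ 2 := by positivity
    linarith
  · intro x hxS hxT
    have h := hnT x hxT
    rw [Wdef, if_pos hxS] at h
    have h1 : 0 ≤ (((S1set S x).card : ℝ) - n / 2) ^ 2 := by positivity
    have h2 : 2 * ((symmDiff (Sfam S 2 x) ((Finset.powersetCard 2 (Finset.univ : Finset (Fin n))) \
      (Finset.powersetCard 2 (S1set S x)))).card : ℝ) ≤ (SDset S x).card := by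
      exact_mod_cast two_symm_le S x
    rw [Nat.cast_choose_two]
    have h3 : δ ^ 2 * (n : ℝ) ^ 2 ≤ δ * (n : ℝ) ^ 2 := by
      gcongr
      nlinarith
    have h4 : δ * (n : ℝ) ^ 2 ≤ δ * (2 * (n * (n - 1))) := by
      gcongr
      nlinarith
    linarith
end

section
/- λ({F_1, F_2, F_3}) = 1/4; that is, exc(n, {F_1,F_2,F_3})/2^n → 1/4 as n → ∞, where exc(n, {F_1,F_2,F_3}) is the maximum size of a subset of V_n that is simultaneously F_1-free, F_2-free and F_3-free. -/
open Finset Filter Topology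

/-- F₁ = {(0,0,0),(1,0,0),(0,1,0),(0,0,1)} ⊆ V₃. -/
def F1 : Set (Fin 3 → Bool) :=
  {![false, false, false], ![true, false, false], ![false, true, false], ![false, false, true]}

/-- F₂ = {(0,0,0),(1,1,0),(1,0,1),(0,1,1)} ⊆ V₃. -/
def F2 : Set (Fin 3 → Bool) :=
  {![false, false, false], ![true, true, false], ![true, false, true], ![false, true, true]}

/-- F₃ = {(0,0,0),(1,1,1)} ⊆ V₃. -/
def F3 : Set (Fin 3 → Bool) :=
  {![false, false, false], ![true, true, true]}

/-- The maximum size of a subset of V_n that is simultaneously F-free, G-free and H-free. -/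
noncomputable def exc3 {d : ℕ} (n : ℕ) (F G H : Set (Fin d → Bool)) : ℕ :=
  sSup {k : ℕ | ∃ S : Finset (Fin n → Bool),
    IsFree F (S : Set (Fin n → Bool)) ∧ IsFree G (S : Set (Fin n → Bool)) ∧
      IsFree H (S : Set (Fin n → Bool)) ∧ S.card = k}

/-- Flip coordinate `a` of `x`. -/
def flp {n : ℕ} (x : Fin n → Bool) (a : Fin n) : Fin n → Bool :=
  Function.update x a (!x a)

lemma flp_apply {n : ℕ} (x : Fin n → Bool) (a j : Fin n) :
    flp x a j = if j = a then !x j else x j := by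
  unfold flp
  by_cases h : j = a
  · subst h; simp
  · simp [h]

lemma flp_flp {n : ℕ} (x : Fin n → Bool) (a : Fin n) : flp (flp x a) a = x := by
  funext j
  simp only [flp_apply]
  split_ifs <;> simp

lemma flp_comm {n : ℕ} (x : Fin n → Bool) (a b : Fin n) :
    flp (flp x a) b = flp (flp x b) a := by
  funext j
  simp only [flp_apply]
  split_ifs <;> simp

/-- Flipping as a permutation of the cube. -/
def flpE {n : ℕ} (a : Fin n) : (Fin n → Bool) ≃ (Fin n → Bool) where
  toFun x := flp x a
  invFun x := flp x a
  left_inv x := flp_flp x a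
  right_inv x := flp_flp x a

lemma exists_flp {n : ℕ} {x y : Fin n → Bool} (h : hammingDist x y = 1) :
    ∃ a, y = flp x a := by
  unfold hammingDist at h
  obtain ⟨a, ha⟩ := Finset.card_eq_one.1 h
  refine ⟨a, ?_⟩
  funext j
  have hj : x j ≠ y j ↔ j = a := by
    have := congrArg (fun s => j ∈ s) ha
    simpa using this
  rw [flp_apply]
  by_cases h : j = a
  · have := hj.2 h
    rw [if_pos h]
    revert this
    cases x j <;> cases y j <;> simp
  · have := mt hj.1 h
    rw [if_neg h]
    simpa using (not_not.1 this).symm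

lemma weight_flp {n : ℕ} (x : Fin n → Bool) (a : Fin n) :
    (cubeWeight (flp x a) : ℤ) = cubeWeight x + (if x a = true then -1 else 1) := by
  unfold cubeWeight
  by_cases h : x a = true
  · have : (univ.filter fun i => x i = true) =
        insert a (univ.filter fun i => flp x a i = true) := by
      ext j
      simp only [mem_filter, mem_univ, true_and, mem_insert, flp_apply]
      by_cases hj : j = a
      · subst hj; simp [h]
      · simp [hj]
    rw [this, card_insert_of_notMem (by simp [flp_apply, h])]
    simp [h]
  · have : (univ.filter fun i => flp x a i = true) =
        insert a (univ.filter fun i => x i = true) := by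
      ext j
      simp only [mem_filter, mem_univ, true_and, mem_insert, flp_apply]
      by_cases hj : j = a
      · subst hj; simp [h]
      · simp [hj]
    rw [this, card_insert_of_notMem (by simp [h])]
    simp [h]

lemma weight_adj {n : ℕ} {x y : Fin n → Bool} (h : hammingDist x y = 1) :
    (cubeWeight y : ℤ) = cubeWeight x + 1 ∨ (cubeWeight y : ℤ) = cubeWeight x - 1 := by
  obtain ⟨a, rfl⟩ := exists_flp h
  rw [weight_flp]
  split_ifs <;> omega

lemma corner {n : ℕ} {x z : Fin n → Bool} {a b : Fin n} (hab : a ≠ b) (hz : z ≠ x)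
    (h1 : hammingDist (flp x a) z = 1) (h2 : hammingDist (flp x b) z = 1) :
    z = flp (flp x a) b := by
  obtain ⟨c, hc⟩ := exists_flp h1
  obtain ⟨d, hd⟩ := exists_flp h2
  have hca : c ≠ a := by
    rintro rfl
    rw [flp_flp] at hc
    exact hz hc
  have hcb : c = b := by
    by_contra hcb
    have e := hc.symm.trans hd
    have ec := congrFun e c
    have ea := congrFun e a
    simp only [flp_apply] at ec ea
    have hcd : c = d := by
      by_contra hcd
      simp [hca, hcb, hcd] at ec
    subst hcd
    simp [hab, hca.symm] at ea
  rw [hc, hcb]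

/-- The vertices of weight `r` modulo 4. -/
def layer (n r : ℕ) : Finset (Fin n → Bool) :=
  univ.filter fun x => cubeWeight x % 4 = r

lemma layer_free {n r : ℕ} :
    IsFree F1 (layer n r : Set (Fin n → Bool)) ∧ IsFree F2 (layer n r : Set (Fin n → Bool)) ∧
      IsFree F3 (layer n r : Set (Fin n → Bool)) := by
  refine ⟨?_, ?_, ?_⟩
  · rintro i ⟨-, hi⟩ hS
    have h0 : i ![false, false, false] ∈ (layer n r : Set _) := hS ⟨_, by simp [F1], rfl⟩
    have h1 : i ![true, false, false] ∈ (layer n r : Set _) := hS ⟨_, by simp [F1], rfl⟩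
    have := weight_adj (hi ![false, false, false] ![true, false, false] (by decide))
    simp only [layer, coe_filter, mem_univ, true_and, Set.mem_ofPred_eq] at h0 h1
    omega
  · rintro i ⟨hinj, hi⟩ hS
    have h0 : i ![false, false, false] ∈ (layer n r : Set _) := hS ⟨_, by simp [F2], rfl⟩
    have h1 : i ![true, true, false] ∈ (layer n r : Set _) := hS ⟨_, by simp [F2], rfl⟩
    have h2 : i ![true, false, true] ∈ (layer n r : Set _) := hS ⟨_, by simp [F2], rfl⟩
    have h3 : i ![false, true, true] ∈ (layer n r : Set _) := hS ⟨_, by simp [F2], rfl⟩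
    simp only [layer, coe_filter, mem_univ, true_and, Set.mem_ofPred_eq] at h0 h1 h2 h3
    obtain ⟨a, ha⟩ := exists_flp (hi ![false, false, false] ![true, false, false] (by decide))
    obtain ⟨b, hb⟩ := exists_flp (hi ![false, false, false] ![false, true, false] (by decide))
    obtain ⟨c, hc⟩ := exists_flp (hi ![false, false, false] ![false, false, true] (by decide))
    have hab : a ≠ b := by
      rintro rfl
      exact absurd (hinj (ha.trans hb.symm)) (by decide)
    have hac : a ≠ c := by
      rintro rfl
      exact absurd (hinj (ha.trans hc.symm)) (by decide)
    have hbc : b ≠ c := by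
      rintro rfl
      exact absurd (hinj (hb.trans hc.symm)) (by decide)
    have e1 := corner hab (hinj.ne (by decide))
      (ha ▸ hi ![true, false, false] ![true, true, false] (by decide))
      (hb ▸ hi ![false, true, false] ![true, true, false] (by decide))
    have e2 := corner hac (hinj.ne (by decide))
      (ha ▸ hi ![true, false, false] ![true, false, true] (by decide))
      (hc ▸ hi ![false, false, true] ![true, false, true] (by decide))
    have e3 := corner hbc (hinj.ne (by decide))
      (hb ▸ hi ![false, true, false] ![false, true, true] (by decide))
      (hc ▸ hi ![false, false, true] ![false, true, true] (by decide))
    rw [e1] at h1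
    rw [e2] at h2
    rw [e3] at h3
    generalize i ![false, false, false] = x at *
    have w1 := weight_flp (flp x a) b
    have w2 := weight_flp (flp x a) c
    have w3 := weight_flp (flp x b) c
    rw [weight_flp x a, flp_apply, if_neg hab.symm] at w1
    rw [weight_flp x a, flp_apply, if_neg hac.symm] at w2
    rw [weight_flp x b, flp_apply, if_neg hbc.symm] at w3
    split_ifs at w1 w2 w3 <;> first | omega | (simp_all; done)
  · rintro i ⟨-, hi⟩ hS
    have h0 : i ![false, false, false] ∈ (layer n r : Set _) := hS ⟨_, by simp [F3], rfl⟩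
    have h1 : i ![true, true, true] ∈ (layer n r : Set _) := hS ⟨_, by simp [F3], rfl⟩
    have := weight_adj (hi ![false, false, false] ![true, false, false] (by decide))
    have := weight_adj (hi ![true, false, false] ![true, true, false] (by decide))
    have := weight_adj (hi ![true, true, false] ![true, true, true] (by decide))
    simp only [layer, coe_filter, mem_univ, true_and, Set.mem_ofPred_eq] at h0 h1
    omega

lemma exists_layer (n : ℕ) (hn : 2 ≤ n) : ∃ r, 2 ^ n ≤ 4 * (layer n r).card := by
  have hd : 4 * 2 ^ (n - 2) = 2 ^ n := by
    obtain ⟨m, rfl⟩ := Nat.exists_eq_add_of_le hn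
    rw [Nat.add_sub_cancel_left, pow_add]; norm_num
  obtain ⟨r, -, hr⟩ := Finset.exists_le_card_fiber_of_mul_le_card_of_maps_to
    (s := (univ : Finset (Fin n → Bool))) (t := Finset.range 4) (n := 2 ^ (n - 2))
    (f := fun x => cubeWeight x % 4)
    (fun x _ => by simpa using Nat.mod_lt _ (by norm_num)) ⟨0, by simp⟩
    (by simp [hd])
  refine ⟨r, ?_⟩
  unfold layer
  omega

/-- The standard subcube through `y` in directions `σ`. -/
def sub {n : ℕ} (y : Fin n → Bool) (σ : Fin 3 → Fin n) (v : Fin 3 → Bool) : Fin n → Bool :=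
  fun j => xor (y j) (decide (∃ k, σ k = j ∧ v k = true))

lemma sub_emb {n : ℕ} (y : Fin n → Bool) (σ : Fin 3 → Fin n) (hσ : Function.Injective σ) :
    IsCubeEmbedding (sub y σ) := by
  have key : ∀ v k, sub y σ v (σ k) = xor (y (σ k)) (v k) := by
    intro v k
    unfold sub
    congr 1
    have : (∃ k', σ k' = σ k ∧ v k' = true) ↔ v k = true :=
      ⟨fun ⟨k', h, h'⟩ => hσ h ▸ h', fun h => ⟨k, rfl, h⟩⟩
    simp [this]
  refine ⟨?_, ?_⟩
  · intro v w h
    funext k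
    have := congrFun h (σ k)
    rw [key, key] at this
    simpa using this
  · intro v w h
    rw [← h]
    unfold hammingDist
    rw [← Finset.card_image_of_injective _ hσ]
    congr 1
    ext j
    simp only [mem_filter, mem_univ, true_and, mem_image]
    constructor
    · intro hj
      by_cases hk : ∃ k, σ k = j
      · obtain ⟨k, rfl⟩ := hk
        refine ⟨k, ?_, rfl⟩
        intro e
        rw [key, key, e] at hj
        exact hj rfl
      · exfalso
        apply hj
        unfold sub
        congr 2
        have e1 : ∀ u : Fin 3 → Bool, (∃ k, σ k = j ∧ u k = true) ↔ False := fun u =>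
          ⟨fun ⟨k, h, _⟩ => hk ⟨k, h⟩, False.elim⟩
        exact propext ((e1 v).trans (e1 w).symm)
    · rintro ⟨k, hk, rfl⟩
      rw [key, key]
      simpa using hk

lemma inj3 {n : ℕ} {a b c : Fin n} (hab : a ≠ b) (hac : a ≠ c) (hbc : b ≠ c) :
    Function.Injective ![a, b, c] := by
  intro i j h
  fin_cases i <;> fin_cases j <;> simp_all

lemma sub_000 {n : ℕ} (y : Fin n → Bool) (σ : Fin 3 → Fin n) :
    sub y σ ![false, false, false] = y := by
  funext j
  simp [sub, Fin.exists_fin_succ]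

lemma free_F2 {n : ℕ} {S : Finset (Fin n → Bool)} (h : IsFree F2 (S : Set (Fin n → Bool)))
    {y : Fin n → Bool} {a b c : Fin n} (hab : a ≠ b) (hac : a ≠ c) (hbc : b ≠ c)
    (h0 : y ∈ S) (h1 : flp (flp y a) b ∈ S) (h2 : flp (flp y a) c ∈ S)
    (h3 : flp (flp y b) c ∈ S) : False := by
  refine h _ (sub_emb y ![a, b, c] (inj3 hab hac hbc)) ?_
  have e1 : sub y ![a, b, c] ![true, true, false] = flp (flp y a) b := by
    funext j
    simp only [sub, Fin.exists_fin_succ, flp_apply]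
    by_cases ha : j = a <;> by_cases hb : j = b <;> simp_all [eq_comm]
  have e2 : sub y ![a, b, c] ![true, false, true] = flp (flp y a) c := by
    funext j
    simp only [sub, Fin.exists_fin_succ, flp_apply]
    by_cases ha : j = a <;> by_cases hb : j = c <;> simp_all [eq_comm]
  have e3 : sub y ![a, b, c] ![false, true, true] = flp (flp y b) c := by
    funext j
    simp only [sub, Fin.exists_fin_succ, flp_apply]
    by_cases ha : j = b <;> by_cases hb : j = c <;> simp_all [eq_comm]
  rintro _ ⟨v, hv, rfl⟩
  simp only [F2, Set.mem_insert_iff, Set.mem_singleton_iff] at hv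
  rcases hv with rfl | rfl | rfl | rfl
  · rw [sub_000]; exact h0
  · rw [e1]; exact h1
  · rw [e2]; exact h2
  · rw [e3]; exact h3

lemma free_F3 {n : ℕ} {S : Finset (Fin n → Bool)} (h : IsFree F3 (S : Set (Fin n → Bool)))
    {y : Fin n → Bool} {a b c : Fin n} (hab : a ≠ b) (hac : a ≠ c) (hbc : b ≠ c)
    (h0 : y ∈ S) (h1 : flp (flp (flp y a) b) c ∈ S) : False := by
  refine h _ (sub_emb y ![a, b, c] (inj3 hab hac hbc)) ?_
  have e1 : sub y ![a, b, c] ![true, true, true] = flp (flp (flp y a) b) c := by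
    funext j
    simp only [sub, Fin.exists_fin_succ, flp_apply]
    by_cases ha : j = a <;> by_cases hb : j = b <;> by_cases hc : j = c <;> simp_all [eq_comm]
  rintro _ ⟨v, hv, rfl⟩
  simp only [F3, Set.mem_insert_iff, Set.mem_singleton_iff] at hv
  rcases hv with rfl | rfl
  · rw [sub_000]; exact h0
  · rw [e1]; exact h1

/-- Indicator. -/
noncomputable def ind {n : ℕ} (S : Finset (Fin n → Bool)) (x : Fin n → Bool) : ℝ :=
  if x ∈ S then 1 else 0

lemma ind_le {n : ℕ} (S : Finset (Fin n → Bool)) (x : Fin n → Bool) : ind S x ≤ 1 := by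
  unfold ind; split_ifs <;> norm_num

lemma mantel {n : ℕ} {S : Finset (Fin n → Bool)} (h : IsFree F2 (S : Set (Fin n → Bool)))
    {y : Fin n → Bool} (hy : y ∈ S) :
    ∑ a, ∑ b, ind S (flp (flp y a) b) ≤ (n : ℝ) + (n : ℝ) ^ 2 / 2 := by
  classical
  let G : SimpleGraph (Fin n) :=
    { Adj := fun a b => a ≠ b ∧ flp (flp y a) b ∈ S
      symm := ⟨fun a b hab => ⟨hab.1.symm, flp_comm y a b ▸ hab.2⟩⟩
      loopless := ⟨fun a ha => ha.1 rfl⟩ }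
  have hG : G.CliqueFree (2 + 1) := by
    intro t ht
    obtain ⟨a, b, c, hab, hac, hbc, -⟩ := SimpleGraph.is3Clique_iff.1 ht
    exact free_F2 h hab.1 hac.1 hbc.1 hy hab.2 hac.2 hbc.2
  have h1 := hG.card_edgeFinset_le
  have h2 : 2 * (2 * #G.edgeFinset) ≤ n ^ 2 := by
    simp only [Fintype.card_fin] at h1
    rcases Nat.mod_two_eq_zero_or_one n with e | e <;> rw [e] at h1 <;>
      norm_num [Nat.choose] at h1 <;> omega
  rw [G.two_mul_card_edgeFinset] at h2
  have h3 : ∑ a, ∑ b, ind S (flp (flp y a) b) ≤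
      ∑ a, ∑ b, ((if a = b then (1 : ℝ) else 0) + (if G.Adj a b then 1 else 0)) := by
    refine sum_le_sum fun a _ => sum_le_sum fun b _ => ?_
    by_cases hab : a = b
    · have := ind_le S (flp (flp y a) b)
      rw [if_pos hab]
      split_ifs <;> linarith
    · have : G.Adj a b ↔ flp (flp y a) b ∈ S := ⟨fun h => h.2, fun h => ⟨hab, h⟩⟩
      simp [hab, this, ind]
  have h4 : ∑ a, ∑ b, (if G.Adj a b then (1 : ℝ) else 0) =
      ((univ.filter fun p : Fin n × Fin n => G.Adj p.1 p.2).card : ℝ) := by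
    rw [← Fintype.sum_prod_type' (f := fun a b => if G.Adj a b then (1 : ℝ) else 0)]
    rw [← Finset.sum_boole]
  simp only [sum_add_distrib] at h3
  rw [h4] at h3
  have h5 : (2 : ℝ) * ((univ.filter fun p : Fin n × Fin n => G.Adj p.1 p.2).card : ℝ)
      ≤ (n : ℝ) ^ 2 := by exact_mod_cast h2
  simp only [Finset.sum_ite_eq, mem_univ, if_true, sum_const, card_univ, Fintype.card_fin, nsmul_eq_mul, mul_one] at h3
  linarith

lemma triple {n : ℕ} {S : Finset (Fin n → Bool)} (h : IsFree F3 (S : Set (Fin n → Bool)))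
    {y : Fin n → Bool} (hy : y ∈ S) :
    ∑ a, ∑ b, ∑ c, ind S (flp (flp (flp y a) b) c) ≤ 3 * (n : ℝ) ^ 2 := by
  have h3 : ∑ a, ∑ b, ∑ c, ind S (flp (flp (flp y a) b) c) ≤
      ∑ a : Fin n, ∑ b : Fin n, ∑ c : Fin n, ((if a = b then (1 : ℝ) else 0) +
        (if a = c then (1 : ℝ) else 0) + (if b = c then (1 : ℝ) else 0)) := by
    refine sum_le_sum fun a _ => sum_le_sum fun b _ => sum_le_sum fun c _ => ?_
    have := ind_le S (flp (flp (flp y a) b) c)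
    by_cases hab : a = b
    · rw [if_pos hab]; split_ifs <;> linarith
    by_cases hac : a = c
    · rw [if_pos hac]; split_ifs <;> linarith
    by_cases hbc : b = c
    · rw [if_pos hbc]; split_ifs <;> linarith
    have hn : flp (flp (flp y a) b) c ∉ S := fun hc => free_F3 h hab hac hbc hy hc
    simp [ind, hn, hab, hac, hbc]
  refine h3.trans (le_of_eq ?_)
  simp [sum_add_distrib]
  ring

lemma sum_flp {n : ℕ} (a : Fin n) (g : (Fin n → Bool) → ℝ) :
    ∑ x, g (flp x a) = ∑ x, g x := Equiv.sum_comp (flpE a) g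

lemma upper {n : ℕ} (hn : 0 < n) {S : Finset (Fin n → Bool)}
    (h2 : IsFree F2 (S : Set (Fin n → Bool))) (h3 : IsFree F3 (S : Set (Fin n → Bool))) :
    (S.card : ℝ) / 2 ^ n ≤ 1 / 4 + 2 / n := by
  set f := ind S with hf
  set M : ℝ := (S.card : ℝ) with hM
  set N : ℝ := 2 ^ n with hN
  have hnR : (0 : ℝ) < n := by exact_mod_cast hn
  have hNpos : 0 < N := by positivity
  have hsum : ∑ x, f x = M := by simp [hf, ind, hM]
  let g : (Fin n → Bool) → ℝ := fun x => ∑ a, f (flp x a)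
  have hg : ∑ x, g x = n * M := by
    simp only [g]
    rw [sum_comm]
    simp [sum_flp, hsum]
  have hA : ∑ x, g x ^ 2 ≤ M * (n + (n : ℝ) ^ 2 / 2) := by
    have e : ∑ x, g x ^ 2 = ∑ y, f y * ∑ a, ∑ b, f (flp (flp y a) b) := by
      calc ∑ x, g x ^ 2 = ∑ x, ∑ a, f (flp x a) * ∑ b, f (flp x b) := by
            simp only [g, sq, sum_mul]
        _ = ∑ a, ∑ x, f (flp x a) * ∑ b, f (flp x b) := sum_comm
        _ = ∑ a, ∑ y, f y * ∑ b, f (flp (flp y a) b) := by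
            refine sum_congr rfl fun a _ => ?_
            rw [← sum_flp a]
            simp only [flp_flp]
        _ = _ := by
            rw [sum_comm]
            simp only [mul_sum]
    rw [e, ← hsum, sum_mul]
    refine sum_le_sum fun y _ => ?_
    by_cases hy : y ∈ S
    · have := mantel h2 hy
      simpa [hf, ind, hy] using this
    · simp [hf, ind, hy]
  have hB : ∑ x, ∑ c, g x * g (flp x c) ≤ M * (3 * (n : ℝ) ^ 2) := by
    have e : ∑ x, ∑ c, g x * g (flp x c) =
        ∑ y, f y * ∑ a, ∑ b, ∑ c, f (flp (flp (flp y a) b) c) := by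
      calc ∑ x, ∑ c, g x * g (flp x c)
          = ∑ x, ∑ a, f (flp x a) * ∑ c, g (flp x c) := by
            refine sum_congr rfl fun x _ => ?_
            rw [← mul_sum, ← sum_mul]
        _ = ∑ a, ∑ x, f (flp x a) * ∑ c, g (flp x c) := sum_comm
        _ = ∑ a, ∑ y, f y * ∑ c, g (flp (flp y a) c) := by
            refine sum_congr rfl fun a _ => ?_
            rw [← sum_flp a]
            simp only [flp_flp]
        _ = _ := by
            rw [sum_comm]
            simp only [mul_sum, g]
    rw [e, ← hsum, sum_mul]
    refine sum_le_sum fun y _ => ?_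
    by_cases hy : y ∈ S
    · have := triple h3 hy
      simpa [hf, ind, hy] using this
    · simp [hf, ind, hy]
  have hCS := sq_sum_le_card_mul_sum_sq (s := (univ : Finset ((Fin n → Bool) × Fin n)))
    (f := fun p => g p.1 + g (flp p.1 p.2))
  rw [Fintype.sum_prod_type, Fintype.sum_prod_type] at hCS
  have e1 : ∑ x, ∑ c, (g x + g (flp x c)) = 2 * n * (n * M) := by
    simp only [sum_add_distrib]
    rw [sum_comm (f := fun x c => g (flp x c))]
    simp only [sum_flp, sum_const, card_univ, Fintype.card_fin, nsmul_eq_mul, ← mul_sum, hg]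
    ring
  have e2 : ∑ x, ∑ c, (g x + g (flp x c)) ^ 2 =
      2 * n * ∑ x, g x ^ 2 + 2 * ∑ x, ∑ c, g x * g (flp x c) := by
    have : ∀ x c, (g x + g (flp x c)) ^ 2 =
      g x ^ 2 + g (flp x c) ^ 2 + 2 * (g x * g (flp x c)) := fun x c => by ring
    simp only [this, sum_add_distrib]
    rw [sum_comm (f := fun x c => g (flp x c) ^ 2)]
    simp only [fun c => sum_flp c (fun x => g x ^ 2), sum_const, card_univ, Fintype.card_fin,
      nsmul_eq_mul, ← mul_sum]
    ring
  have e3 : ((univ : Finset ((Fin n → Bool) × Fin n)).card : ℝ) = N * n := by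
    simp [hN]
  simp only [e1, e2, e3] at hCS
  have hM0 : 0 ≤ M := by positivity
  have hfin : (2 * n * (n * M)) ^ 2 ≤
      N * n * (2 * n * (M * (n + (n : ℝ) ^ 2 / 2)) + 2 * (M * (3 * (n : ℝ) ^ 2))) := by
    refine hCS.trans ?_
    gcongr
  have hfac : 4 * (n : ℝ) ^ 3 * M * (n * M) ≤ 4 * (n : ℝ) ^ 3 * M * (N * (n / 4 + 2)) := by
    nlinarith [hfin]
  rw [div_le_iff₀ hNpos]
  rcases hM0.eq_or_lt with h0 | h0
  · rw [← h0]; positivity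
  · have := le_of_mul_le_mul_left hfac (by positivity)
    have e : (1 / 4 + 2 / (n : ℝ)) * N = N * (n / 4 + 2) / n := by
      field_simp
    rw [e, le_div_iff₀ hnR]
    linarith

/-- λ({F₁, F₂, F₃}) = 1/4. -/
theorem lambda_F1F2F3 :
    Filter.Tendsto (fun n : ℕ => (exc3 n F1 F2 F3 : ℝ) / 2 ^ n) Filter.atTop (𝓝 (1 / 4)) := by
  have hlim : Tendsto (fun n : ℕ => (1 / 4 : ℝ) + 2 / n) atTop (𝓝 (1 / 4)) := by
    simpa using (tendsto_const_nhds (x := (1 / 4 : ℝ))).add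
      (tendsto_const_div_atTop_nhds_zero_nat (2 : ℝ))
  refine tendsto_of_tendsto_of_tendsto_of_le_of_le' tendsto_const_nhds hlim ?_ ?_
  · filter_upwards [eventually_ge_atTop 2] with n hn
    obtain ⟨r, hr⟩ := exists_layer n hn
    have hle : (layer n r).card ≤ exc3 n F1 F2 F3 := by
      unfold exc3
      refine le_csSup ⟨Fintype.card (Fin n → Bool), ?_⟩
        ⟨layer n r, layer_free.1, layer_free.2.1, layer_free.2.2, rfl⟩
      rintro k ⟨S, -, -, -, rfl⟩
      exact card_le_univ S
    rw [le_div_iff₀ (by positivity)]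
    have h1 : (2 : ℝ) ^ n ≤ 4 * ((layer n r).card : ℝ) := by exact_mod_cast hr
    have h2 : ((layer n r).card : ℝ) ≤ exc3 n F1 F2 F3 := by exact_mod_cast hle
    linarith
  · filter_upwards [eventually_ge_atTop 2] with n hn
    have hmem : exc3 n F1 F2 F3 ∈ {k : ℕ | ∃ S : Finset (Fin n → Bool),
        IsFree F1 (S : Set (Fin n → Bool)) ∧ IsFree F2 (S : Set (Fin n → Bool)) ∧
        IsFree F3 (S : Set (Fin n → Bool)) ∧ S.card = k} := by
      refine Nat.sSup_mem
        ⟨_, layer n 0, layer_free.1, layer_free.2.1, layer_free.2.2, rfl⟩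
        ⟨Fintype.card (Fin n → Bool), ?_⟩
      rintro k ⟨S, -, -, -, rfl⟩
      exact card_le_univ S
    obtain ⟨S, -, h2, h3, hS⟩ := hmem
    rw [← hS]
    exact upper (by omega) h2 h3
end
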